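/- Let (Ω, F, P) be a probability space with filtration (F_t)_{t∈ℕ} and let (Y_t)_{t≥0} be an adapted, integrable process with E[(Y_t − E[Y_t | F_{t−1}])²] ≤ L for all t ≥ 1 and some L > 0. If (Y_t) is a submartingale, then liminf_{n→∞} Y_n / n ≥ 0 P-almost surely; if (Y_t) is a supermartingale, then limsup_{n→∞} Y_n / n ≤ 0 P-almost surely. -/

import Mathlib

open MeasureTheory Filter Finset
open scoped ENNReal NNReal

/-- Kronecker's lemma for weights `1/(t+1)`. -/
lemma lrl_kronecker (d : ℕ → ℝ) (c : ℝ)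
    (h : Tendsto (fun n => ∑ t ∈ range n, d t / ((t : ℝ) + 1)) atTop (nhds c)) :
    Tendsto (fun n : ℕ => (∑ t ∈ range n, d t) / (n : ℝ)) atTop (nhds 0) := by
  set S : ℕ → ℝ := fun n => ∑ t ∈ range n, d t / ((t : ℝ) + 1) with hS
  have key : ∀ n : ℕ, ∑ t ∈ range n, d t = n * S n - ∑ t ∈ range n, S t := by
    intro n
    induction n with
    | zero => simp
    | succ n ih =>
      have h1 : S (n + 1) = S n + d n / ((n : ℝ) + 1) := by
        simp only [hS, sum_range_succ]
      have h2 : (n : ℝ) + 1 ≠ 0 := by positivity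
      rw [sum_range_succ, sum_range_succ, ih, h1]
      push_cast
      field_simp
      ring
  have h2 := h.sub h.cesaro
  rw [sub_self] at h2
  refine h2.congr' ?_
  filter_upwards [eventually_gt_atTop 0] with n hn
  have hn' : (n : ℝ) ≠ 0 := by positivity
  rw [key]
  field_simp

lemma lrl_martingale_lln
    {Ω : Type*} {m0 : MeasurableSpace Ω} (μ : Measure Ω) [IsProbabilityMeasure μ]
    (ℱ : Filtration ℕ m0) (D : ℕ → Ω → ℝ)
    (hm : ∀ t, StronglyMeasurable[ℱ (t + 1)] (D t)) (hD : ∀ t, MemLp (D t) 2 μ)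
    (hc : ∀ t, μ[D t | ℱ t] =ᵐ[μ] 0) (L : ℝ) (hL : 0 < L)
    (hv : ∀ t, ∫ ω, D t ω ^ 2 ∂μ ≤ L) :
    ∀ᵐ ω ∂μ, Tendsto (fun n : ℕ => (∑ t ∈ range n, D t ω) / (n : ℝ)) atTop (nhds 0) := by
  let S : ℕ → Ω → ℝ := fun n ω => ∑ t ∈ range n, D t ω / ((t : ℝ) + 1)
  have hS0 : S 0 = 0 := by ext ω; simp [S]
  have hSs : ∀ n, S (n + 1) = S n + fun ω => ((n : ℝ) + 1)⁻¹ * D n ω := by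
    intro n; ext ω; simp [S, sum_range_succ, div_eq_inv_mul]
  have hSa : StronglyAdapted ℱ S := by
    intro n
    induction n with
    | zero => rw [hS0]; exact stronglyMeasurable_zero
    | succ n ih =>
      rw [hSs]
      exact (ih.mono (ℱ.mono n.le_succ)).add ((hm n).const_mul _)
  have hS2 : ∀ n, MemLp (S n) 2 μ := by
    intro n
    induction n with
    | zero => rw [hS0]; exact MemLp.zero
    | succ n ih => rw [hSs]; exact ih.add ((hD n).const_mul _)
  have hDi : ∀ t, Integrable (D t) μ := fun t => (hD t).integrable (by norm_num)
  have hSi : ∀ t, Integrable (S t) μ := fun t => (hS2 t).integrable (by norm_num)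
  have hmart : Martingale S ℱ μ := by
    refine martingale_of_condExp_sub_eq_zero_nat hSa hSi fun n => ?_
    have : S (n + 1) - S n = ((n : ℝ) + 1)⁻¹ • D n := by
      rw [hSs]; ext ω; simp
    rw [this]
    filter_upwards [condExp_smul (μ := μ) (((n : ℝ) + 1)⁻¹) (D n) (ℱ n), hc n] with ω h1 h2
    rw [h1]; simp [h2]
  have horth : ∀ n, ∫ ω, S n ω * D n ω ∂μ = 0 := by
    intro n
    have hi : Integrable (S n * D n) μ := (hS2 n).integrable_mul (hD n)
    have h1 := condExp_mul_of_stronglyMeasurable_left (hSa n) hi (hDi n)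
    have h2 : ∫ ω, (μ[S n * D n | ℱ n]) ω ∂μ = ∫ ω, (S n * D n) ω ∂μ := integral_condExp (ℱ.le n)
    have h3 : ∫ ω, (μ[S n * D n | ℱ n]) ω ∂μ = 0 := by
      apply integral_eq_zero_of_ae
      filter_upwards [h1, hc n] with ω a b
      rw [a]; simp [b]
    rw [h3] at h2
    exact h2.symm
  have hsq : ∀ n, ∫ ω, S n ω ^ 2 ∂μ ≤ L * ∑ t ∈ range n, 1 / ((t : ℝ) + 1) ^ 2 := by
    intro n
    induction n with
    | zero => simp [hS0]
    | succ n ih =>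
      have e : ∀ ω, S (n + 1) ω ^ 2 = S n ω ^ 2 + (2 * ((n : ℝ) + 1)⁻¹) * (S n ω * D n ω)
          + (((n : ℝ) + 1)⁻¹) ^ 2 * D n ω ^ 2 := by
        intro ω; rw [hSs]; simp only [Pi.add_apply]; ring
      have i1 : Integrable (fun ω => S n ω ^ 2) μ := (hS2 n).integrable_sq
      have i2 : Integrable (fun ω => (2 * ((n : ℝ) + 1)⁻¹) * (S n ω * D n ω)) μ :=
        ((hS2 n).integrable_mul (hD n)).const_mul _
      have i3 : Integrable (fun ω => (((n : ℝ) + 1)⁻¹) ^ 2 * D n ω ^ 2) μ :=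
        (hD n).integrable_sq.const_mul _
      have i12 : Integrable (fun ω => S n ω ^ 2 + (2 * ((n : ℝ) + 1)⁻¹) * (S n ω * D n ω)) μ :=
        i1.add i2
      simp_rw [e]
      rw [integral_add i12 i3, integral_add i1 i2, integral_const_mul,
        integral_const_mul, horth, sum_range_succ, mul_add]
      have : (((n : ℝ) + 1)⁻¹) ^ 2 * ∫ ω, D n ω ^ 2 ∂μ ≤ (((n : ℝ) + 1)⁻¹) ^ 2 * L :=
        mul_le_mul_of_nonneg_left (hv n) (by positivity)
      have e2 : L * (1 / ((n : ℝ) + 1) ^ 2) = (((n : ℝ) + 1)⁻¹) ^ 2 * L := by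
        rw [inv_pow]; ring
      rw [e2]
      linarith
  have hsum : Summable fun t : ℕ => 1 / ((t : ℝ) + 1) ^ 2 := by
    have := (summable_nat_add_iff 1).2 (Real.summable_one_div_nat_pow.2 (one_lt_two))
    simpa using this
  set C : ℝ := ∑' t : ℕ, 1 / ((t : ℝ) + 1) ^ 2
  have hsq' : ∀ n, ∫ ω, S n ω ^ 2 ∂μ ≤ L * C := fun n => (hsq n).trans
    (mul_le_mul_of_nonneg_left (hsum.sum_le_tsum _ fun i _ => by positivity) hL.le)
  have hbd : ∀ n, eLpNorm (S n) 1 μ ≤ ((1 + L * C).toNNReal : ℝ≥0) := by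
    intro n
    rw [eLpNorm_one_eq_lintegral_enorm, ← ofReal_integral_norm_eq_lintegral_enorm (hSi n)]
    apply ENNReal.ofReal_le_ofReal
    calc ∫ ω, ‖S n ω‖ ∂μ ≤ ∫ ω, (1 + S n ω ^ 2) ∂μ := by
          refine integral_mono (hSi n).norm ((integrable_const _).add (hS2 n).integrable_sq) ?_
          intro ω
          simp only [Real.norm_eq_abs]
          nlinarith [sq_abs (S n ω), sq_nonneg (|S n ω| - 1), abs_nonneg (S n ω)]
      _ = 1 + ∫ ω, S n ω ^ 2 ∂μ := by
          rw [integral_add (integrable_const _) (hS2 n).integrable_sq]; simp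
      _ ≤ 1 + L * C := by linarith [hsq' n]
  filter_upwards [hmart.submartingale.exists_ae_tendsto_of_bdd hbd] with ω ⟨c, hω⟩
  exact lrl_kronecker _ c hω

lemma lrl_liminf (u v : ℕ → ℝ) (hv : Tendsto v atTop (nhds 0)) (h : ∀ᶠ n in atTop, v n ≤ u n) :
    0 ≤ liminf u atTop := by
  rw [liminf_eq]
  by_cases hb : BddAbove {a | ∀ᶠ n in atTop, a ≤ u n}
  · refine le_of_forall_lt fun a ha => ?_
    obtain ⟨b, hab, hb0⟩ := exists_between ha
    refine hab.trans_le (le_csSup hb ?_)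
    filter_upwards [h, hv.eventually (lt_mem_nhds hb0)] with n h1 h2
    exact h2.le.trans h1
  · rw [Real.sSup_of_not_bddAbove hb]

lemma lrl_limsup (u v : ℕ → ℝ) (hv : Tendsto v atTop (nhds 0)) (h : ∀ᶠ n in atTop, u n ≤ v n) :
    limsup u atTop ≤ 0 := by
  rw [limsup_eq]
  by_cases hb : BddBelow {a | ∀ᶠ n in atTop, u n ≤ a}
  · refine le_of_forall_gt fun a ha => ?_
    obtain ⟨b, hb0, hab⟩ := exists_between ha
    refine lt_of_le_of_lt (csInf_le hb ?_) hab
    filter_upwards [h, hv.eventually (gt_mem_nhds hb0)] with n h1 h2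
    exact h1.trans h2.le
  · rw [Real.sInf_of_not_bddBelow hb]

/-- Long-run law for sub- and supermartingales: under Assumption II, a submartingale
satisfies `liminf Y_n / n ≥ 0` a.s., and a supermartingale satisfies
`limsup Y_n / n ≤ 0` a.s. -/
theorem long_run_law_sub_supermartingale
    {Ω : Type*} {m0 : MeasurableSpace Ω} (μ : Measure Ω) [IsProbabilityMeasure μ]
    (ℱ : Filtration ℕ m0) (Y : ℕ → Ω → ℝ)
    (hadp : Adapted ℱ Y) (hint : ∀ t, Integrable (Y t) μ)
    (L : ℝ) (hL : 0 < L)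
    (hvar : ∀ t, 1 ≤ t →
      ∫⁻ ω, (‖Y t ω - (μ[Y t | ℱ (t - 1)]) ω‖₊ : ℝ≥0∞) ^ 2 ∂μ ≤ ENNReal.ofReal L) :
    (Submartingale Y ℱ μ →
      ∀ᵐ ω ∂μ, 0 ≤ Filter.liminf (fun n : ℕ => Y n ω / (n : ℝ)) atTop) ∧
    (Supermartingale Y ℱ μ →
      ∀ᵐ ω ∂μ, Filter.limsup (fun n : ℕ => Y n ω / (n : ℝ)) atTop ≤ 0) := by
  have hs : StronglyAdapted ℱ Y := hadp.stronglyAdapted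
  let D : ℕ → Ω → ℝ := fun t => Y (t + 1) - μ[Y (t + 1) | ℱ t]
  have hm : ∀ t, StronglyMeasurable[ℱ (t + 1)] (D t) := fun t =>
    (hs (t + 1)).sub (stronglyMeasurable_condExp.mono (ℱ.mono t.le_succ))
  have hlint : ∀ t, ∫⁻ ω, ‖D t ω‖ₑ ^ 2 ∂μ ≤ ENNReal.ofReal L := fun t => hvar (t + 1) (by omega)
  have hD : ∀ t, MemLp (D t) 2 μ := by
    intro t
    refine ⟨((hm t).mono (ℱ.le _)).aestronglyMeasurable, ?_⟩
    rw [eLpNorm_lt_top_iff_lintegral_rpow_enorm_lt_top (by norm_num) (by norm_num)]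
    refine lt_of_le_of_lt ?_ (ENNReal.ofReal_lt_top (r := L))
    simpa using hlint t
  have hv : ∀ t, ∫ ω, D t ω ^ 2 ∂μ ≤ L := by
    intro t
    rw [← ENNReal.ofReal_le_ofReal_iff hL.le,
      ofReal_integral_eq_lintegral_ofReal (hD t).integrable_sq (ae_of_all _ fun ω => sq_nonneg _)]
    refine le_trans (le_of_eq (lintegral_congr fun ω => ?_)) (hlint t)
    rw [Real.enorm_eq_ofReal_abs, ← ENNReal.ofReal_pow (abs_nonneg _), sq_abs]
  have hc : ∀ t, μ[D t | ℱ t] =ᵐ[μ] 0 := by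
    intro t
    have h1 := condExp_sub (hint (t + 1)) (integrable_condExp (μ := μ) (m := ℱ t) (f := Y (t + 1)))
      (ℱ t)
    have h2 : μ[μ[Y (t + 1) | ℱ t] | ℱ t] = μ[Y (t + 1) | ℱ t] :=
      condExp_of_stronglyMeasurable (ℱ.le t) stronglyMeasurable_condExp integrable_condExp
    rw [h2, sub_self] at h1
    exact h1
  have hlln := lrl_martingale_lln μ ℱ D hm hD hc L hL hv
  have hlim : ∀ᵐ ω ∂μ, Tendsto (fun n : ℕ => (Y 0 ω + ∑ t ∈ range n, D t ω) / (n : ℝ))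
      atTop (nhds 0) := by
    filter_upwards [hlln] with ω h
    have := (tendsto_const_div_atTop_nhds_zero_nat (Y 0 ω)).add h
    simpa [add_div] using this
  constructor
  · intro hsub
    have hle : ∀ᵐ ω ∂μ, ∀ t, Y t ω ≤ (μ[Y (t + 1) | ℱ t]) ω :=
      ae_all_iff.2 fun t => hsub.2.1 t (t + 1) t.le_succ
    filter_upwards [hlim, hle] with ω h1 h2
    refine lrl_liminf _ _ h1 (Eventually.of_forall fun n => ?_)
    refine div_le_div_of_nonneg_right ?_ (Nat.cast_nonneg n)
    induction n with
    | zero => simp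
    | succ n ih =>
      rw [sum_range_succ]
      have := h2 n
      have e : D n ω = Y (n + 1) ω - (μ[Y (n + 1) | ℱ n]) ω := rfl
      linarith
  · intro hsup
    have hle : ∀ᵐ ω ∂μ, ∀ t, (μ[Y (t + 1) | ℱ t]) ω ≤ Y t ω :=
      ae_all_iff.2 fun t => hsup.2.1 t (t + 1) t.le_succ
    filter_upwards [hlim, hle] with ω h1 h2
    refine lrl_limsup _ _ h1 (Eventually.of_forall fun n => ?_)
    refine div_le_div_of_nonneg_right ?_ (Nat.cast_nonneg n)
    induction n with
    | zero => simp
    | succ n ih =>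
      rw [sum_range_succ]
      have := h2 n
      have e : D n ω = Y (n + 1) ω - (μ[Y (n + 1) | ℱ n]) ω := rfl
      linarith
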